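/- The Salzmann operation ∗ on ℝ has the inverse property: (x ∗ t) ∗ (−t) = x for all x, t ∈ ℝ. -/

import Mathlib

/-- The Salzmann operation on `ℝ`:
`x * t = x + t/2` if `x/t ≤ -3/2` or `x/t ≥ 1`,
`x * t = x/2 + t` if `-2/3 ≤ x/t ≤ 1`,
`x * t = 2x + 2t` if `-3/2 ≤ x/t ≤ -2/3`, and `x * 0 = x`.
(The clauses agree on the overlaps of the regions, so the nested `if`
below defines exactly this operation.) -/
noncomputable def salz (x t : ℝ) : ℝ :=
  if t = 0 then x
  else if x / t ≤ -(3 / 2) ∨ 1 ≤ x / t then x + t / 2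
  else if -(2 / 3) ≤ x / t then x / 2 + t
  else 2 * x + 2 * t

/-- Homogeneity reduces the operation to a function of the ratio `x / t`. -/
theorem salz_mul_self (r : ℝ) {t : ℝ} (ht : t ≠ 0) :
    salz (r * t) t =
      (if r ≤ -(3 / 2) ∨ 1 ≤ r then r + 1 / 2
        else if -(2 / 3) ≤ r then r / 2 + 1 else 2 * r + 2) * t := by
  rw [salz, if_neg ht, mul_div_cancel_right₀ r ht]
  split_ifs <;> ring

/-- the Salzmann operation has the inverse property. -/
theorem stmt_13 : ∀ x t : ℝ, salz (salz x t) (-t) = x := by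
  intro x t
  rcases eq_or_ne t 0 with rfl | ht
  · simp [salz]
  obtain ⟨r, rfl⟩ : ∃ r, x = r * t := ⟨x / t, (div_mul_cancel₀ x ht).symm⟩
  rw [salz_mul_self r ht, ← neg_mul_neg, salz_mul_self _ (neg_ne_zero.mpr ht), ← neg_mul_neg r t]
  congr 1
  grind
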